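/- Let X and Y be finite-dimensional with dim Y < dim X, let T be a compact metric space, and let x̄ ∈ Ω. Assume each g_t is Fréchet differentiable on a ball B_η(x̄), the mappings t ↦ g_t(x̄) and (x,t) ↦ ∇g_t(x) (on B_η(x̄) × T) are continuous, and the EMFCQ holds at x̄. Then N(x̄; Ω) = cone{∇g_t(x̄) : t ∈ T(x̄)} + ∇h(x̄)*(Y*). -/

import Mathlib

open Filter Topology Set Pointwise

section Defs

variable {X : Type*} [NormedAddCommGroup X] [NormedSpace ℝ X]

/-- The canonical identification of the dual of `X` with its weak* dual. -/
def toWD (p : X →L[ℝ] ℝ) : WeakDual ℝ X := p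

/-- The weak* closure of a subset of the dual. -/
def wkClosure (S : Set (X →L[ℝ] ℝ)) : Set (X →L[ℝ] ℝ) :=
  {p | toWD p ∈ closure (toWD '' S)}

/-- A subset of the dual is weak* closed. -/
def IsWeakStarClosed (S : Set (X →L[ℝ] ℝ)) : Prop :=
  IsClosed (toWD '' S)

/-- A subset of `X* × ℝ` is weak* closed. -/
def IsWeakStarClosedProd (S : Set ((X →L[ℝ] ℝ) × ℝ)) : Prop :=
  IsClosed ((fun p : (X →L[ℝ] ℝ) × ℝ => (toWD p.1, p.2)) '' S)

/-- The convex conic hull of `S ∪ {0}`: all finite nonnegative combinations of elements of `S`. -/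
def coneHull {E : Type*} [AddCommMonoid E] [Module ℝ E] (S : Set E) : Set E :=
  {x | ∃ (n : ℕ) (c : Fin n → ℝ) (v : Fin n → E),
    (∀ i, 0 ≤ c i) ∧ (∀ i, v i ∈ S) ∧ x = ∑ i, c i • v i}

/-- The set of ε-normals to `Ω` at `x`. -/
def epsNormal (Ω : Set X) (x : X) (ε : ℝ) : Set (X →L[ℝ] ℝ) :=
  {p | ∀ γ > (0:ℝ), ∃ δ > (0:ℝ), ∀ u ∈ Ω, ‖u - x‖ < δ → p (u - x) ≤ (ε + γ) * ‖u - x‖}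

/-- The Fréchet (regular) normal cone to `Ω` at `x`. -/
def frechetNormal (Ω : Set X) (x : X) : Set (X →L[ℝ] ℝ) := epsNormal Ω x 0

/-- The limiting (Mordukhovich) normal cone to `Ω` at `xb`. -/
def limitingNormal (Ω : Set X) (xb : X) : Set (X →L[ℝ] ℝ) :=
  {p | ∃ (ε : ℕ → ℝ) (xs : ℕ → X) (ps : ℕ → X →L[ℝ] ℝ),
    (∀ n, 0 ≤ ε n) ∧ Tendsto ε atTop (𝓝 0) ∧
    (∀ n, xs n ∈ Ω) ∧ Tendsto xs atTop (𝓝 xb) ∧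
    (∀ n, ps n ∈ epsNormal Ω (xs n) (ε n)) ∧
    (∀ v : X, Tendsto (fun n => ps n v) atTop (𝓝 (p v)))}

/-- The normal cone of convex analysis to `Ω` at `xb`. -/
def convexNormal (Ω : Set X) (xb : X) : Set (X →L[ℝ] ℝ) :=
  {p | ∀ x ∈ Ω, p (x - xb) ≤ 0}

/-- The subdifferential of convex analysis of `f` at `xb`. -/
def convexSubdiff (f : X → ℝ) (xb : X) : Set (X →L[ℝ] ℝ) :=
  {p | ∀ x, f xb + p (x - xb) ≤ f x}

variable {Y : Type*} [NormedAddCommGroup Y] [NormedSpace ℝ Y]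

/-- The image `A*(Y*)` of the adjoint operator `A* : Y* → X*`. -/
def adjRange (A : X →L[ℝ] Y) : Set (X →L[ℝ] ℝ) :=
  Set.range fun q : Y →L[ℝ] ℝ => q.comp A

variable {T : Type*}

/-- Uniform Fréchet differentiability of the family `g = (g t)` at `xb`:
`s(η) := sup_t sup_{x ∈ B_η(xb), x ≠ xb} |g t x - g t xb - ⟨dg t, x - xb⟩|/‖x - xb‖ → 0` as `η ↓ 0`. -/
def UnifFrechetDiffAt (g : T → X → ℝ) (dg : T → X →L[ℝ] ℝ) (xb : X) : Prop :=
  ∀ ε > (0:ℝ), ∃ η > (0:ℝ), ∀ t : T, ∀ x : X, ‖x - xb‖ ≤ η →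
    |g t x - g t xb - dg t (x - xb)| ≤ ε * ‖x - xb‖

/-- Uniform strict differentiability of the family `g = (g t)` at `xb`:
`r(η) := sup_t sup_{x,x' ∈ B_η(xb), x ≠ x'} |g t x - g t x' - ⟨dg t, x - x'⟩|/‖x - x'‖ → 0`
as `η ↓ 0`. -/
def UnifStrictDiffAt (g : T → X → ℝ) (dg : T → X →L[ℝ] ℝ) (xb : X) : Prop :=
  ∀ ε > (0:ℝ), ∃ η > (0:ℝ), ∀ t : T, ∀ x x' : X, ‖x - xb‖ ≤ η → ‖x' - xb‖ ≤ η →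
    |g t x - g t x' - dg t (x - x')| ≤ ε * ‖x - x'‖

/-- The inequality part of the PMFCQ at `xb` with the direction `xt`:
`inf_{ε>0} sup_{t ∈ T_ε(xb)} ⟨dg t, xt⟩ < 0`, where `T_ε(xb) = {t | g t xb ≥ -ε}`. -/
def PMFCQat (g : T → X → ℝ) (dg : T → X →L[ℝ] ℝ) (xb xt : X) : Prop :=
  ∃ ε > (0:ℝ), ∃ δ > (0:ℝ), ∀ t : T, -ε ≤ g t xb → dg t xt ≤ -δ

end Defs

section Helpers

theorem coneHull_add_mem {E : Type*} [AddCommMonoid E] [Module ℝ E] {S : Set E} {x y : E}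
    (hx : x ∈ coneHull S) (hy : y ∈ coneHull S) : x + y ∈ coneHull S := by
  obtain ⟨n, c, v, hc, hv, rfl⟩ := hx
  obtain ⟨m, d, w, hd, hw, rfl⟩ := hy
  refine ⟨n + m, Fin.append c d, Fin.append v w, ?_, ?_, ?_⟩
  · intro i
    refine Fin.addCases (fun i => ?_) (fun i => ?_) i
    · simpa using hc i
    · simpa using hd i
  · intro i
    refine Fin.addCases (fun i => ?_) (fun i => ?_) i
    · simpa using hv i
    · simpa using hw i
  · simp [Fin.sum_univ_add]

theorem coneHull_smul_mem {E : Type*} [AddCommMonoid E] [Module ℝ E] {S : Set E} {x : E}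
    {a : ℝ} (ha : 0 ≤ a) (hx : x ∈ coneHull S) : a • x ∈ coneHull S := by
  obtain ⟨n, c, v, hc, hv, rfl⟩ := hx
  exact ⟨n, fun i => a * c i, v, fun i => mul_nonneg ha (hc i), hv, by
    simp [Finset.smul_sum, mul_smul]⟩

theorem coneHull_zero_mem {E : Type*} [AddCommMonoid E] [Module ℝ E] {S : Set E} :
    (0 : E) ∈ coneHull S :=
  ⟨0, Fin.elim0, Fin.elim0, fun i => i.elim0, fun i => i.elim0, by simp⟩

theorem coneHull_subset_mem {E : Type*} [AddCommMonoid E] [Module ℝ E] {S : Set E} {x : E}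
    (hx : x ∈ S) : x ∈ coneHull S :=
  ⟨1, fun _ => 1, fun _ => x, fun _ => zero_le_one, fun _ => hx, by simp⟩

theorem coneHull_apply_nonpos {X : Type*} [NormedAddCommGroup X] [NormedSpace ℝ X]
    {S : Set (X →L[ℝ] ℝ)} {k : X →L[ℝ] ℝ} (hk : k ∈ coneHull S) {v : X}
    (hv : ∀ a ∈ S, a v < 0) : k v ≤ 0 := by
  obtain ⟨n, c, w, hc, hw, rfl⟩ := hk
  rw [ContinuousLinearMap.sum_apply]
  refine Finset.sum_nonpos fun i _ => ?_
  have := hv _ (hw i)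
  have := hc i
  simp only [ContinuousLinearMap.smul_apply, smul_eq_mul]
  nlinarith

theorem compact_hull_aux {E : Type*} [NormedAddCommGroup E] [NormedSpace ℝ E]
    [FiniteDimensional ℝ E] {s : Set E} (hs : IsCompact s) : IsCompact (convexHull ℝ s) := by
  classical
  let N := Module.finrank ℝ E + 1
  let Φ : (Fin N → ℝ) × (Fin N → E) → E := fun q => ∑ i, q.1 i • q.2 i
  have hΦ : Continuous Φ := by fun_prop
  have hK : IsCompact (Φ '' (stdSimplex ℝ (Fin N) ×ˢ Set.univ.pi fun _ => s)) :=
    ((isCompact_stdSimplex ℝ (Fin N)).prod (isCompact_univ_pi fun _ => hs)).image hΦ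
  convert hK using 1
  apply Set.Subset.antisymm
  · intro x hx
    obtain ⟨ι, hι, z, w, hz, hai, hw, hw1, rfl⟩ := eq_pos_convex_span_of_mem_convexHull hx
    have hcard : Fintype.card ι ≤ Fintype.card (Fin N) := by
      rw [Fintype.card_fin]
      exact hai.card_le_finrank_succ.trans (Nat.succ_le_succ (Submodule.finrank_le _))
    obtain ⟨e⟩ := Function.Embedding.nonempty_of_card_le hcard
    obtain ⟨a0, ha0⟩ : s.Nonempty := convexHull_nonempty_iff.1 ⟨_, hx⟩
    have hwe : ∀ i, Function.extend e w 0 (e i) = w i := fun i => e.injective.extend_apply _ _ _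
    have hze : ∀ i, Function.extend e z (fun _ => a0) (e i) = z i :=
      fun i => e.injective.extend_apply _ _ _
    have hwn : ∀ j, j ∉ Set.range e → Function.extend e w 0 j = 0 := fun j hj =>
      Function.extend_apply' _ _ _ hj
    have hzn : ∀ j, j ∉ Set.range e → Function.extend e z (fun _ => a0) j = a0 := fun j hj =>
      Function.extend_apply' _ _ _ hj
    refine ⟨(Function.extend e w 0, Function.extend e z fun _ => a0), ⟨⟨?_, ?_⟩, ?_⟩, ?_⟩
    · intro j
      by_cases hj : j ∈ Set.range e
      · obtain ⟨i, rfl⟩ := hj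
        exact (hw i).le.trans_eq (hwe i).symm
      · exact (hwn j hj).ge
    · rw [← hw1]
      symm
      refine Finset.sum_of_injOn e e.injective.injOn (by simp) (fun j _ hj => ?_)
        (fun i _ => (hwe i).symm)
      exact hwn j (by simpa using hj)
    · intro j _
      by_cases hj : j ∈ Set.range e
      · obtain ⟨i, rfl⟩ := hj
        simp only [hze]
        exact hz ⟨i, rfl⟩
      · simp only [hzn j hj]
        exact ha0
    · symm
      refine Finset.sum_of_injOn e e.injective.injOn (by simp) (fun j _ hj => ?_)
        (fun i _ => by simp only [hwe, hze])
      simp only [hwn j (by simpa using hj), zero_smul]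
  · rintro _ ⟨⟨w, z⟩, ⟨hw, hz⟩, rfl⟩
    exact (convex_convexHull ℝ s).sum_mem (fun i _ => hw.1 i) hw.2
      (fun i _ => subset_convexHull ℝ s (hz i (Set.mem_univ i)))

theorem sep_aux {X Y : Type*} [NormedAddCommGroup X] [NormedSpace ℝ X]
    [FiniteDimensional ℝ X] [NormedAddCommGroup Y] [NormedSpace ℝ Y] [FiniteDimensional ℝ Y]
    (A : Set (X →L[ℝ] ℝ)) (hA : IsCompact A) (dh : X →L[ℝ] Y)
    (xt : X) (hxt : dh xt = 0) (hAx : ∀ a ∈ A, a xt < 0) (p : X →L[ℝ] ℝ)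
    (hp : p ∉ coneHull A + adjRange dh) :
    ∃ v : X, dh v = 0 ∧ (∀ a ∈ A, a v < 0) ∧ 0 < p v := by
  classical
  let Rl : (Y →L[ℝ] ℝ) →ₗ[ℝ] (X →L[ℝ] ℝ) :=
    { toFun := fun q => q.comp dh
      map_add' := fun a b => by ext; simp
      map_smul' := fun a b => by ext; simp }
  let R : Submodule ℝ (X →L[ℝ] ℝ) := LinearMap.range Rl
  have hRmem : ∀ q : Y →L[ℝ] ℝ, q.comp dh ∈ R := fun q => ⟨q, rfl⟩
  have hRcl : IsClosed (R : Set (X →L[ℝ] ℝ)) := R.closed_of_finiteDimensional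
  let D := convexHull ℝ (insert (-p) A)
  have hDc : IsCompact D := compact_hull_aux (hA.insert (-p))
  let S : Set (X →L[ℝ] ℝ) :=
    {z | ∃ k ∈ coneHull A, ∃ s : ℝ, 0 ≤ s ∧ 0 < s - k xt ∧ z = k - s • p}
  have hSconv : Convex ℝ S := by
    rintro z1 ⟨k1, hk1, s1, hs1, h1, rfl⟩ z2 ⟨k2, hk2, s2, hs2, h2, rfl⟩ a b ha hb hab
    refine ⟨a • k1 + b • k2,
      coneHull_add_mem (coneHull_smul_mem ha hk1) (coneHull_smul_mem hb hk2),
      a * s1 + b * s2, by positivity, ?_, ?_⟩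
    · simp only [ContinuousLinearMap.add_apply, ContinuousLinearMap.smul_apply, smul_eq_mul]
      rcases eq_or_lt_of_le ha with h0 | h0
      · have : b = 1 := by linarith
        subst this; subst h0; linarith
      · nlinarith [mul_pos h0 h1, mul_nonneg hb h2.le]
    · module
  have hDS : D ⊆ S := by
    refine convexHull_min ?_ hSconv
    rintro z hz
    rcases Set.mem_insert_iff.1 hz with rfl | hz
    · exact ⟨0, coneHull_zero_mem, 1, by norm_num, by simp, by simp⟩
    · exact ⟨z, coneHull_subset_mem hz, 0, le_rfl, by have := hAx z hz; linarith, by simp⟩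
  have hdisj : Disjoint D (R : Set (X →L[ℝ] ℝ)) := by
    rw [Set.disjoint_left]
    intro z hzD hzR
    obtain ⟨k, hk, s, hs, hks, rfl⟩ := hDS hzD
    obtain ⟨q, hq⟩ := hzR
    have hq' : q.comp dh = k - s • p := hq
    rcases eq_or_lt_of_le hs with h0 | h0
    · have := congrArg (fun f : X →L[ℝ] ℝ => f xt) hq'
      simp [hxt, ← h0] at this
      linarith
    · apply hp
      refine Set.mem_add.2 ⟨s⁻¹ • k, coneHull_smul_mem (by positivity) hk,
        (-(s⁻¹) • q).comp dh, ⟨_, rfl⟩, ?_⟩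
      rw [ContinuousLinearMap.smul_comp, hq', smul_sub, smul_smul]
      have : -s⁻¹ * s = -1 := by field_simp
      rw [this]
      module
  obtain ⟨f, u, w, hfu, huw, hfw⟩ :=
    geometric_hahn_banach_compact_closed (convex_convexHull ℝ _) hDc R.convex hRcl hdisj
  have hw0 : w < 0 := by simpa using hfw 0 R.zero_mem
  have hfR : ∀ r ∈ R, f r = 0 := by
    intro r hr
    by_contra hne
    have := hfw ((w / f r) • r) (R.smul_mem _ hr)
    rw [map_smul, smul_eq_mul, div_mul_cancel₀ _ hne] at this
    exact lt_irrefl _ this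
  -- the functional is an evaluation
  let F : Module.Dual ℝ (Module.Dual ℝ X) :=
    f.toLinearMap.comp (LinearMap.toContinuousLinearMap (𝕜 := ℝ) (E := X) (F' := ℝ)).toLinearMap
  obtain ⟨v, hv⟩ := (Module.evalEquiv ℝ X).surjective F
  have hfv : ∀ q : X →L[ℝ] ℝ, f q = q v := by
    intro q
    have := congrArg (fun G => G (q : X →ₗ[ℝ] ℝ)) hv
    simp only [Module.evalEquiv_apply] at this
    have h2 : LinearMap.toContinuousLinearMap (q : X →ₗ[ℝ] ℝ) = q := by ext; rfl
    simp only [F, LinearMap.comp_apply] at this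
    exact (this.trans (congrArg f h2)).symm
  have hneg : ∀ z ∈ insert (-p) A, z v < 0 := by
    intro z hz
    have := hfu z (subset_convexHull ℝ _ hz)
    rw [hfv] at this
    linarith
  refine ⟨v, ?_, fun a ha => hneg a (Set.mem_insert_of_mem _ ha), ?_⟩
  · by_contra hne
    obtain ⟨q, -, hq⟩ := exists_dual_vector ℝ (dh v) (norm_ne_zero_iff.2 hne)
    have := hfR _ (hRmem q)
    rw [hfv] at this
    simp only [ContinuousLinearMap.comp_apply] at this
    rw [this] at hq
    exact hne (norm_eq_zero.1 (by simpa using hq.symm))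
  · have := hneg (-p) (Set.mem_insert _ _)
    simpa using this

theorem unif_aux {X T : Type*} [NormedAddCommGroup X] [NormedSpace ℝ X]
    [FiniteDimensional ℝ X] [MetricSpace T] [CompactSpace T]
    (g : T → X → ℝ) (dg : T → X → X →L[ℝ] ℝ) (xb : X) (η : ℝ)
    (hη : 0 < η)
    (hgd : ∀ t : T, ∀ x ∈ Metric.closedBall xb η, HasFDerivAt (g t) (dg t x) x)
    (hc2 : ContinuousOn (fun p : X × T => dg p.2 p.1) (Metric.closedBall xb η ×ˢ univ)) :
    UnifStrictDiffAt g (fun t => dg t xb) xb := by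
  intro ε hε
  haveI : ProperSpace X := FiniteDimensional.proper ℝ X
  have hcomp : IsCompact (Metric.closedBall xb η ×ˢ (univ : Set T)) :=
    (isCompact_closedBall xb η).prod isCompact_univ
  have huc := hcomp.uniformContinuousOn_of_continuous hc2
  rw [Metric.uniformContinuousOn_iff] at huc
  obtain ⟨δ, hδ, H⟩ := huc ε hε
  refine ⟨min η (δ / 2), by positivity, ?_⟩
  intro t x x' hx hx'
  have key := Convex.norm_image_sub_le_of_norm_hasFDerivWithin_le' (𝕜 := ℝ) (f := g t)
    (f' := fun x => dg t x) (φ := dg t xb) (C := ε)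
    (s := Metric.closedBall xb (min η (δ / 2))) (x := x') (y := x)
    (fun z hz => (hgd t z (Metric.closedBall_subset_closedBall (min_le_left _ _) hz)).hasFDerivWithinAt)
    (fun z hz => by
      have hz1 := Metric.closedBall_subset_closedBall (min_le_left _ _) hz
      have hz2 := Metric.closedBall_subset_closedBall (min_le_right _ _) hz
      have := H (z, t) ⟨hz1, mem_univ _⟩ (xb, t) ⟨Metric.mem_closedBall_self hη.le, mem_univ _⟩
        (by
          rw [Prod.dist_eq]
          simp only [dist_self]
          rw [Metric.mem_closedBall] at hz2
          exact max_lt (by linarith) hδ)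
      rw [dist_eq_norm] at this
      exact this.le)
    (convex_closedBall _ _) (by simpa [dist_eq_norm] using hx') (by simpa [dist_eq_norm] using hx)
  simpa [Real.norm_eq_abs] using key

theorem feas_aux {X Y T : Type*} [NormedAddCommGroup X] [NormedSpace ℝ X]
    [FiniteDimensional ℝ X] [NormedAddCommGroup Y] [NormedSpace ℝ Y] [FiniteDimensional ℝ Y]
    [MetricSpace T] [CompactSpace T]
    (g : T → X → ℝ) (dg : T → X →L[ℝ] ℝ) (h : X → Y) (dh : X →L[ℝ] Y) (xb : X)
    (hU : UnifStrictDiffAt g dg xb)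
    (hhd : HasStrictFDerivAt h dh xb)
    (hc1 : Continuous fun t : T => g t xb) (hc2 : Continuous dg)
    (hxb : ∀ t, g t xb ≤ 0)
    (hsurj : Function.Surjective dh) (v : X) (hv : dh v = 0)
    (hvg : ∀ t, g t xb = 0 → dg t v < 0) (κ₀ : ℝ) (hκ₀ : 0 < κ₀) :
    ∃ ρ > 0, ∀ x, h x = 0 → (∀ t, g t x ≤ 0) → ‖x - xb‖ < ρ → ∀ τ, 0 < τ → τ < ρ →
      ∃ u, (h u = 0 ∧ ∀ t, g t u ≤ 0) ∧ ‖u - x - τ • v‖ ≤ κ₀ * τ := by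
  haveI : CompleteSpace X := FiniteDimensional.complete ℝ X
  haveI : CompleteSpace Y := FiniteDimensional.complete ℝ Y
  obtain ⟨m, hm, hmt⟩ : ∃ m : ℝ, 0 < m ∧ ∀ t ∈ (univ : Set T), m ≤ max (-g t xb) (-dg t v) := by
    refine isCompact_univ.exists_forall_le' (f := fun t => max (-g t xb) (-dg t v)) ?_ ?_
    · have : Continuous fun t => dg t v := hc2.clm_apply continuous_const
      fun_prop
    · intro t _
      rcases eq_or_lt_of_le (hxb t) with h0 | h0
      · exact lt_max_of_lt_right (by have := hvg t h0; linarith)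
      · exact lt_max_of_lt_left (by linarith)
  obtain ⟨G, hG0, hG⟩ : ∃ G : ℝ, 0 ≤ G ∧ ∀ t, ‖dg t‖ ≤ G := by
    obtain ⟨C, hC⟩ := isCompact_univ.exists_bound_of_continuousOn (f := dg) hc2.continuousOn
    exact ⟨max C 0, le_max_right _ _, fun t => (hC t (mem_univ t)).trans (le_max_left _ _)⟩
  obtain ⟨κ, hκ, hκκ, hκG⟩ : ∃ κ : ℝ, 0 < κ ∧ κ ≤ κ₀ ∧ G * κ ≤ m / 2 := by
    refine ⟨min κ₀ (m / (2 * (G + 1))), by positivity, min_le_left _ _, ?_⟩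
    calc G * min κ₀ (m / (2 * (G + 1))) ≤ (G + 1) * (m / (2 * (G + 1))) := by
          gcongr
          · linarith
          · exact min_le_right _ _
      _ = m / 2 := by field_simp
  set V := ‖v‖ + κ with hV
  have hVpos : 0 < V := by positivity
  obtain ⟨η, hη, hηU⟩ := hU (m / (2 * V)) (by positivity)
  -- right inverse
  have hrange : dh.range = ⊤ := LinearMap.range_eq_top.2 hsurj
  let inv := dh.nonlinearRightInverseOfSurjective hrange
  have hM : 0 < inv.nnnorm := dh.nonlinearRightInverseOfSurjective_nnnorm_pos hrange
  let c : NNReal := inv.nnnorm⁻¹ * (⟨κ, hκ.le⟩ / ⟨V, hVpos.le⟩)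
  have hcval : (c : ℝ) = (inv.nnnorm : ℝ)⁻¹ * (κ / V) := rfl
  have hc : 0 < c := by
    rw [← NNReal.coe_pos, hcval]
    have : (0:ℝ) < inv.nnnorm := hM
    positivity
  obtain ⟨s, hs, happ⟩ := hhd.approximates_deriv_on_nhds (Or.inr hc)
  obtain ⟨r, hr, hrs⟩ := Metric.mem_nhds_iff.1 hs
  set L := G + m / (2 * V) with hL
  have hLpos : 0 < L := by positivity
  obtain ⟨R, hR, hRη, hRr, hRL⟩ : ∃ R : ℝ, 0 < R ∧ R ≤ η ∧ R < r ∧ L * R ≤ m := by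
    refine ⟨min η (min (r / 2) (m / L)), by positivity, min_le_left _ _, ?_, ?_⟩
    · have := (min_le_right η (min (r / 2) (m / L))).trans (min_le_left _ _)
      linarith
    · have := (min_le_right η (min (r / 2) (m / L))).trans (min_le_right _ _)
      calc L * _ ≤ L * (m / L) := by gcongr
        _ = m := by field_simp
  refine ⟨R / (1 + V), by positivity, ?_⟩
  intro x hx hgx hxρ τ hτ hτρ
  have hbig : ∀ u, ‖u - x - τ • v‖ ≤ κ * τ → ‖u - x‖ ≤ V * τ ∧ ‖u - xb‖ ≤ R := by
    intro u hu
    have h1 : ‖u - x‖ ≤ V * τ := by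
      calc ‖u - x‖ = ‖(u - x - τ • v) + τ • v‖ := by congr 1; abel
        _ ≤ κ * τ + τ * ‖v‖ := by
            refine (norm_add_le _ _).trans ?_
            rw [norm_smul, Real.norm_of_nonneg hτ.le]
            linarith
        _ = V * τ := by rw [hV]; ring
    refine ⟨h1, ?_⟩
    calc ‖u - xb‖ = ‖(u - x) + (x - xb)‖ := by congr 1; abel
      _ ≤ V * τ + R / (1 + V) := (norm_add_le _ _).trans (by linarith)
      _ ≤ V * (R / (1 + V)) + R / (1 + V) := by gcongr
      _ = R := by field_simp; ring
  have hsub : Metric.closedBall (x + τ • v) (κ * τ) ⊆ s := by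
    intro u hu
    apply hrs
    rw [Metric.mem_closedBall, dist_eq_norm, ← sub_sub] at hu
    rw [Metric.mem_ball, dist_eq_norm]
    exact (hbig u hu).2.trans_lt hRr
  have hxR : ‖x - xb‖ ≤ R := by
    refine hxρ.le.trans (div_le_self hR.le (by linarith))
  have hxs : x ∈ s := hrs (by rw [Metric.mem_ball, dist_eq_norm]; exact hxR.trans_lt hRr)
  have hbs : x + τ • v ∈ s := hsub (Metric.mem_closedBall_self (by positivity))
  have hhb : ‖h (x + τ • v)‖ ≤ c * (τ * ‖v‖) := by
    have := happ _ hbs _ hxs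
    simpa [hx, hv, norm_smul, abs_of_pos hτ] using this
  have hsurjOn := happ.surjOn_closedBall_of_nonlinearRightInverse inv
    (by positivity : (0:ℝ) ≤ κ * τ) hsub
  have h0 : (0 : Y) ∈ Metric.closedBall (h (x + τ • v))
      (((inv.nnnorm : ℝ)⁻¹ - c) * (κ * τ)) := by
    rw [Metric.mem_closedBall, dist_eq_norm, zero_sub, norm_neg]
    refine hhb.trans ?_
    have : (c : ℝ) * V = (inv.nnnorm : ℝ)⁻¹ * κ := by rw [hcval]; field_simp
    have h2 : ((inv.nnnorm : ℝ)⁻¹ - c) * (κ * τ) = c * (τ * ‖v‖) := by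
      have : (c : ℝ) * (‖v‖ + κ) = (inv.nnnorm : ℝ)⁻¹ * κ := this
      linear_combination (-τ) * this
    exact h2.ge
  obtain ⟨u, huB, hu0⟩ := hsurjOn h0
  rw [Metric.mem_closedBall, dist_eq_norm, ← sub_sub] at huB
  obtain ⟨hux, huxb⟩ := hbig u huB
  refine ⟨u, ⟨hu0, fun t => ?_⟩, huB.trans (by gcongr)⟩
  rcases le_max_iff.1 (hmt t (mem_univ t)) with hh | hh
  · have h1 := (abs_le.1 (hηU t u xb (huxb.trans hRη) (by simpa using hη.le))).2
    have h2 : dg t (u - xb) ≤ G * ‖u - xb‖ :=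
      (le_abs_self _).trans ((dg t).le_of_opNorm_le (hG t) _)
    have h3 : L * ‖u - xb‖ ≤ m := (mul_le_mul_of_nonneg_left huxb hLpos.le).trans hRL
    rw [hL, add_mul] at h3
    linarith
  · have h1 := (abs_le.1 (hηU t u x (huxb.trans hRη) (hxR.trans hRη))).2
    have h2 : dg t (u - x - τ • v) ≤ G * (κ * τ) :=
      ((le_abs_self _).trans ((dg t).le_of_opNorm_le (hG t) _)).trans (by gcongr)
    have h3 : m / (2 * V) * ‖u - x‖ ≤ m / 2 * τ := by
      calc m / (2 * V) * ‖u - x‖ ≤ m / (2 * V) * (V * τ) := by gcongr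
        _ = m / 2 * τ := by field_simp
    have h4 : dg t (u - x) = dg t (u - x - τ • v) + τ * dg t v := by
      simp
    have h5 : τ * dg t v ≤ τ * (-m) := by gcongr; linarith
    have h6 : G * (κ * τ) ≤ m / 2 * τ := by nlinarith
    have := hgx t
    linarith

theorem epsNormal_add {X : Type*} [NormedAddCommGroup X] [NormedSpace ℝ X] {Ω : Set X} {x : X}
    {p q : X →L[ℝ] ℝ} (hp : p ∈ epsNormal Ω x 0) (hq : q ∈ epsNormal Ω x 0) :
    p + q ∈ epsNormal Ω x 0 := by
  intro γ hγ
  obtain ⟨d1, hd1, h1⟩ := hp (γ / 2) (by positivity)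
  obtain ⟨d2, hd2, h2⟩ := hq (γ / 2) (by positivity)
  refine ⟨min d1 d2, by positivity, fun u hu hux => ?_⟩
  have := h1 u hu (hux.trans_le (min_le_left _ _))
  have := h2 u hu (hux.trans_le (min_le_right _ _))
  rw [ContinuousLinearMap.add_apply]
  linarith

theorem epsNormal_smul {X : Type*} [NormedAddCommGroup X] [NormedSpace ℝ X] {Ω : Set X} {x : X}
    {p : X →L[ℝ] ℝ} {a : ℝ} (ha : 0 ≤ a) (hp : p ∈ epsNormal Ω x 0) :
    a • p ∈ epsNormal Ω x 0 := by
  intro γ hγ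
  obtain ⟨d1, hd1, h1⟩ := hp (γ / (a + 1)) (by positivity)
  refine ⟨d1, hd1, fun u hu hux => ?_⟩
  have := h1 u hu hux
  rw [ContinuousLinearMap.smul_apply, smul_eq_mul]
  calc a * p (u - x) ≤ a * ((0 + γ / (a + 1)) * ‖u - x‖) := by gcongr
    _ ≤ (a + 1) * ((0 + γ / (a + 1)) * ‖u - x‖) := by gcongr; linarith
    _ = _ := by field_simp; ring

theorem epsNormal_zero {X : Type*} [NormedAddCommGroup X] [NormedSpace ℝ X] {Ω : Set X} {x : X} :
    (0 : X →L[ℝ] ℝ) ∈ epsNormal Ω x 0 := by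
  intro γ hγ
  exact ⟨1, one_pos, fun u _ _ => by simp; positivity⟩

end Helpers

/-- let `X, Y` be finite-dimensional with `dim Y < dim X` and `T` a compact
metric space. If each `g t` is Fréchet differentiable on a closed ball around `xb ∈ Ω`, the
maps `t ↦ g t xb` and `(x,t) ↦ dg t x` (on `B_η(xb) × T`) are continuous, and the EMFCQ holds
at `xb`, then the limiting normal cone to `Ω` at `xb` equals
`cone{dg t xb : t ∈ T(xb)} + ∇h(xb)*(Y*)`. -/
theorem statement11 {X Y T : Type*} [NormedAddCommGroup X] [NormedSpace ℝ X]
    [FiniteDimensional ℝ X] [NormedAddCommGroup Y] [NormedSpace ℝ Y] [FiniteDimensional ℝ Y]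
    [MetricSpace T] [CompactSpace T]
    (hdim : Module.finrank ℝ Y < Module.finrank ℝ X)
    (g : T → X → ℝ) (dg : T → X → X →L[ℝ] ℝ) (h : X → Y) (dh : X →L[ℝ] Y) (xb : X) (η : ℝ)
    (hη : 0 < η)
    (hgd : ∀ t : T, ∀ x ∈ Metric.closedBall xb η, HasFDerivAt (g t) (dg t x) x)
    (hhd : HasStrictFDerivAt h dh xb)
    (hxb : xb ∈ {x : X | h x = 0 ∧ ∀ t : T, g t x ≤ 0})
    (hc1 : Continuous fun t : T => g t xb)
    (hc2 : ContinuousOn (fun p : X × T => dg p.2 p.1) (Metric.closedBall xb η ×ˢ univ))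
    (hsurj : Function.Surjective dh)
    (hemfcq : ∃ xt : X, dh xt = 0 ∧ ∀ t : T, g t xb = 0 → dg t xb xt < 0) :
    limitingNormal {x : X | h x = 0 ∧ ∀ t : T, g t x ≤ 0} xb =
      coneHull ((fun t : T => dg t xb) '' {t : T | g t xb = 0}) + adjRange dh := by
  obtain ⟨xt, hxt0, hxt⟩ := hemfcq
  have hU := unif_aux g dg xb η hη hgd hc2
  have hdgc : Continuous fun t => dg t xb := by
    have h1 : Continuous fun t : T => ((xb, t) : X × T) := by fun_prop
    exact hc2.comp_continuous h1 fun t => ⟨Metric.mem_closedBall_self hη.le, mem_univ _⟩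
  have hAc : IsCompact ((fun t : T => dg t xb) '' {t : T | g t xb = 0}) :=
    ((isClosed_eq hc1 continuous_const).isCompact).image hdgc
  apply Set.Subset.antisymm
  · rintro p ⟨ε, xs, ps, hε0, hε, hxs, hxl, hps, hpl⟩
    by_contra hp
    obtain ⟨v, hv0, hvA, hpv⟩ := sep_aux _ hAc dh xt hxt0
      (by rintro _ ⟨t, ht, rfl⟩; exact hxt t ht) p hp
    haveI : CompleteSpace X := FiniteDimensional.complete ℝ X
    obtain ⟨C, hC⟩ : ∃ C, ∀ n, ‖ps n‖ ≤ C := by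
      apply banach_steinhaus
      intro x
      obtain ⟨C, hC⟩ := (hpl x).norm.bddAbove_range
      exact ⟨C, fun n => hC ⟨n, rfl⟩⟩
    have hC0 : 0 ≤ C := (norm_nonneg _).trans (hC 0)
    obtain ⟨κ, hκ, hCκ⟩ : ∃ κ : ℝ, 0 < κ ∧ C * κ ≤ p v / 4 := by
      refine ⟨p v / (4 * (C + 1)), by positivity, ?_⟩
      calc C * (p v / (4 * (C + 1))) ≤ (C + 1) * (p v / (4 * (C + 1))) := by gcongr; linarith
        _ = p v / 4 := by field_simp
    obtain ⟨ρ, hρ, H⟩ := feas_aux g (fun t => dg t xb) h dh xb hU hhd hc1 hdgc hxb.2 hsurj v hv0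
      (fun t ht => hvA _ ⟨t, ht, rfl⟩) κ hκ
    set V := ‖v‖ + κ with hV
    have hVpos : 0 < V := by positivity
    have hepos : 0 < p v / (8 * V) := by positivity
    have e1 : ∀ᶠ n in atTop, ε n < p v / (8 * V) := hε.eventually_lt_const hepos
    have e2 : ∀ᶠ n in atTop, p v / 2 < ps n v := (hpl v).eventually_const_lt (by linarith)
    have e3 : ∀ᶠ n in atTop, ‖xs n - xb‖ < ρ := by
      filter_upwards [hxl.eventually (Metric.ball_mem_nhds xb hρ)] with n hn
      simpa [dist_eq_norm] using hn
    obtain ⟨n, hn1, hn2, hn3⟩ := (e1.and (e2.and e3)).exists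
    obtain ⟨δ, hδ, hN⟩ := hps n _ hepos
    obtain ⟨τ, hτ, hτρ, hτδ⟩ : ∃ τ : ℝ, 0 < τ ∧ τ < ρ ∧ V * τ < δ := by
      refine ⟨min (ρ / 2) (δ / (2 * V)), by positivity, ?_, ?_⟩
      · have := min_le_left (ρ / 2) (δ / (2 * V)); linarith
      · calc V * _ ≤ V * (δ / (2 * V)) := by gcongr; exact min_le_right _ _
          _ = δ / 2 := by field_simp
          _ < δ := by linarith
    obtain ⟨u, hu, hun⟩ := H (xs n) (hxs n).1 (hxs n).2 hn3 τ hτ hτρ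
    have h1 : ‖u - xs n‖ ≤ V * τ := by
      calc ‖u - xs n‖ = ‖(u - xs n - τ • v) + τ • v‖ := by congr 1; abel
        _ ≤ κ * τ + τ * ‖v‖ := by
            refine (norm_add_le _ _).trans ?_
            rw [norm_smul, Real.norm_of_nonneg hτ.le]
            linarith
        _ = V * τ := by rw [hV]; ring
    have h2 := hN u hu (h1.trans_lt hτδ)
    have h3 : -(C * (κ * τ)) ≤ ps n (u - xs n - τ • v) := by
      have := ((ps n).le_of_opNorm_le (hC n) (u - xs n - τ • v)).trans
        (mul_le_mul_of_nonneg_left hun hC0)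
      exact (abs_le.1 this).1
    have h4 : ps n (u - xs n) = ps n (u - xs n - τ • v) + τ * ps n v := by simp
    have h5 : (ε n + p v / (8 * V)) * ‖u - xs n‖ ≤ (p v / 4) * τ := by
      calc (ε n + p v / (8 * V)) * ‖u - xs n‖
          ≤ (p v / (8 * V) + p v / (8 * V)) * (V * τ) := by gcongr
        _ = (p v / 4) * τ := by field_simp; ring
    have h6 : C * (κ * τ) ≤ p v / 4 * τ := by nlinarith
    have h7 : τ * (p v / 2) < τ * ps n v := by gcongr
    linarith
  · intro p hp
    suffices hpe : p ∈ epsNormal {x : X | h x = 0 ∧ ∀ t : T, g t x ≤ 0} xb 0 from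
      ⟨fun _ => 0, fun _ => xb, fun _ => p, fun _ => le_rfl, tendsto_const_nhds, fun _ => hxb,
        tendsto_const_nhds, fun _ => hpe, fun _ => tendsto_const_nhds⟩
    obtain ⟨k, ⟨n, c, w, hc, hw, rfl⟩, _, ⟨q, rfl⟩, rfl⟩ := Set.mem_add.1 hp
    apply epsNormal_add
    · refine Finset.sum_induction _ (· ∈ epsNormal {x : X | h x = 0 ∧ ∀ t : T, g t x ≤ 0} xb 0)
        (fun a b => epsNormal_add) epsNormal_zero fun i _ => epsNormal_smul (hc i) ?_
      obtain ⟨t, ht, hti⟩ := hw i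
      rw [← hti]
      intro γ hγ
      obtain ⟨δ, hδ, hd⟩ := hU γ hγ
      refine ⟨δ, hδ, fun u hu hux => ?_⟩
      have h1 := (abs_le.1 (hd t u xb hux.le (by simpa using hδ.le))).1
      have h2 : g t xb = 0 := ht
      have h3 := hu.2 t
      simp only at h1 ⊢
      linarith
    · intro γ hγ
      have hfd := hhd.hasFDerivAt.isLittleO
      have := hfd.def (c := γ / (‖q‖ + 1)) (by positivity)
      obtain ⟨δ, hδ, hd⟩ := Metric.eventually_nhds_iff.1 this
      refine ⟨δ, hδ, fun u hu hux => ?_⟩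
      have h1 := hd (y := u) (by rwa [dist_eq_norm])
      rw [hu.1, hxb.1, sub_zero, zero_sub, norm_neg] at h1
      calc q (dh (u - xb)) ≤ ‖q‖ * ‖dh (u - xb)‖ := (le_abs_self _).trans (q.le_opNorm _)
        _ ≤ (‖q‖ + 1) * (γ / (‖q‖ + 1) * ‖u - xb‖) := by gcongr; linarith
        _ = (0 + γ) * ‖u - xb‖ := by field_simp; ring
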